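/- arXiv:0808.1480 — 2 statements merged into one kernel-verified Lean document; each statement's English description precedes it below -/
import Mathlib

section
/- Define d_n = (16^n/(n!)²)·c_{4,2n+1} for integers n ≥ 0. Then for every n ≥ 0, (n+2)³d_{n+2} − 2(2n+3)(5n²+15n+12)d_{n+1} + 64(n+1)³d_n = 0. -/
open MeasureTheory

/-- The modified Bessel function `K₀`, via `K₀(x) = ∫₀^∞ exp(−x cosh t) dt`. -/
noncomputable def besselK0 (x : ℝ) : ℝ :=
  ∫ t in Set.Ioi (0 : ℝ), Real.exp (-x * Real.cosh t)

/-- The Bessel moment `c_{m,k} = ∫₀^∞ x^k K₀(x)^m dx`. -/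
noncomputable def besselMoment (m k : ℕ) : ℝ :=
  ∫ x in Set.Ioi (0 : ℝ), x ^ k * besselK0 x ^ m

open Filter Topology Set

/-- The derivatives of `K₀` up to sign: `∫₀^∞ (cosh t)^j exp(−x cosh t) dt`. -/
noncomputable def coshLaplace (j : ℕ) (x : ℝ) : ℝ :=
  ∫ t in Ioi (0 : ℝ), Real.cosh t ^ j * Real.exp (-x * Real.cosh t)

lemma exp_le_two_mul_cosh (t : ℝ) : Real.exp t ≤ 2 * Real.cosh t := by
  rw [Real.cosh_eq]
  linarith [Real.exp_pos (-t)]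

lemma cosh_pow_mul_exp_neg_le (j : ℕ) {x : ℝ} (hx : 0 < x) (t : ℝ) :
    Real.cosh t ^ j * Real.exp (-x * Real.cosh t)
      ≤ (j + 1).factorial / x ^ (j + 1) * 2 * Real.exp (-1 * t) := by
  have hc := Real.cosh_pos t
  have h1 := Real.pow_div_factorial_le_exp (x * Real.cosh t) (by positivity) (j + 1)
  have h2 := exp_le_two_mul_cosh t
  have h3 : Real.exp (-1 * t) = (Real.exp t)⁻¹ := by rw [← Real.exp_neg]; ring_nf
  have h4 : Real.exp (-x * Real.cosh t) = (Real.exp (x * Real.cosh t))⁻¹ := by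
    rw [← Real.exp_neg]; ring_nf
  have hf : (0 : ℝ) < (j + 1).factorial := by positivity
  rw [h3, h4, ← div_eq_mul_inv, ← div_eq_mul_inv, div_le_div_iff₀ (Real.exp_pos _) (Real.exp_pos _)]
  rw [div_le_iff₀ hf, mul_pow] at h1
  calc Real.cosh t ^ j * Real.exp t ≤ Real.cosh t ^ j * (2 * Real.cosh t) := by gcongr
    _ = (x ^ (j + 1) * Real.cosh t ^ (j + 1)) / x ^ (j + 1) * 2 := by
        field_simp
        ring
    _ ≤ (Real.exp (x * Real.cosh t) * (j + 1).factorial) / x ^ (j + 1) * 2 := by gcongr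
    _ = _ := by ring

lemma integrableOn_cosh_pow_mul_exp_neg (j : ℕ) {x : ℝ} (hx : 0 < x) :
    IntegrableOn (fun t => Real.cosh t ^ j * Real.exp (-x * Real.cosh t)) (Ioi 0) := by
  refine Integrable.mono' ((integrableOn_exp_mul_Ioi (a := -1) (by norm_num) 0).const_mul
    ((j + 1).factorial / x ^ (j + 1) * 2)) ?_ ?_
  · exact Continuous.aestronglyMeasurable (by fun_prop)
  · refine Eventually.of_forall fun t => ?_
    rw [Real.norm_of_nonneg (by have := Real.cosh_pos t; positivity)]
    exact cosh_pow_mul_exp_neg_le j hx t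

lemma hasDerivAt_coshLaplace (j : ℕ) {x : ℝ} (hx : 0 < x) :
    HasDerivAt (coshLaplace j) (-coshLaplace (j + 1) x) x := by
  have key := (hasDerivAt_integral_of_dominated_loc_of_deriv_le
    (μ := volume.restrict (Ioi (0 : ℝ))) (s := Ioi (x / 2)) (x₀ := x)
    (F := fun x t => Real.cosh t ^ j * Real.exp (-x * Real.cosh t))
    (F' := fun x t => -(Real.cosh t ^ (j + 1) * Real.exp (-x * Real.cosh t)))
    (bound := fun t => Real.cosh t ^ (j + 1) * Real.exp (-(x / 2) * Real.cosh t))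
    (Ioi_mem_nhds (by linarith))
    (Eventually.of_forall fun y => Continuous.aestronglyMeasurable (by fun_prop))
    (integrableOn_cosh_pow_mul_exp_neg j hx)
    (Continuous.aestronglyMeasurable (by fun_prop))
    (Eventually.of_forall fun t y hy => ?_)
    (integrableOn_cosh_pow_mul_exp_neg (j + 1) (by linarith))
    (Eventually.of_forall fun t y _ => ?_)).2
  · rwa [integral_neg] at key
  · have hc := Real.cosh_pos t
    have hy' : x / 2 ≤ y := le_of_lt hy
    rw [norm_neg, Real.norm_of_nonneg (by positivity)]
    gcongr
  · have h : HasDerivAt (fun y : ℝ => -y * Real.cosh t) (-1 * Real.cosh t) y :=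
      (hasDerivAt_neg y).mul_const _
    refine (h.exp.const_mul (Real.cosh t ^ j)).congr_deriv ?_
    ring

/-- The modified Bessel equation, in integral form. -/
lemma coshLaplace_one {x : ℝ} (hx : 0 < x) :
    coshLaplace 1 x = x * coshLaplace 2 x - x * coshLaplace 0 x := by
  have i0 := integrableOn_cosh_pow_mul_exp_neg 0 hx
  have i1 := integrableOn_cosh_pow_mul_exp_neg 1 hx
  have i2 := integrableOn_cosh_pow_mul_exp_neg 2 hx
  have hlim : Tendsto (fun t => Real.sinh t * Real.exp (-x * Real.cosh t)) atTop (𝓝 0) := by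
    have h0 : Tendsto (fun t : ℝ => (1 + 1).factorial / x ^ (1 + 1) * 2 * Real.exp (-1 * t))
        atTop (𝓝 0) := by
      have := Real.tendsto_exp_neg_atTop_nhds_zero.const_mul
        (((1 + 1).factorial : ℝ) / x ^ (1 + 1) * 2)
      simpa using this
    refine squeeze_zero_norm (fun t => ?_) h0
    refine le_trans ?_ (cosh_pow_mul_exp_neg_le 1 hx t)
    rw [norm_mul, Real.norm_of_nonneg (Real.exp_pos _).le, pow_one]
    gcongr
    exact abs_le_of_sq_le_sq (by linarith [Real.cosh_sq t]) (Real.cosh_pos t).le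
  have i3 : IntegrableOn (fun t => x * (Real.cosh t ^ 2 * Real.exp (-x * Real.cosh t))
      - x * (Real.cosh t ^ 0 * Real.exp (-x * Real.cosh t))) (Ioi 0) :=
    (i2.const_mul x).sub (i0.const_mul x)
  have key := integral_Ioi_of_hasDerivAt_of_tendsto (a := 0)
    (f := fun t => Real.sinh t * Real.exp (-x * Real.cosh t))
    (f' := fun t => Real.cosh t ^ 1 * Real.exp (-x * Real.cosh t)
      - (x * (Real.cosh t ^ 2 * Real.exp (-x * Real.cosh t))
        - x * (Real.cosh t ^ 0 * Real.exp (-x * Real.cosh t))))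
    (Continuous.continuousWithinAt (by fun_prop)) ?_
    (i1.sub i3) hlim
  · rw [integral_sub i1 i3,
      integral_sub (i2.const_mul x) (i0.const_mul x), integral_const_mul, integral_const_mul] at key
    simp only [Real.sinh_zero, zero_mul, sub_zero] at key
    exact sub_eq_zero.mp key
  · intro t _
    refine ((Real.hasDerivAt_sinh t).mul
      ((Real.hasDerivAt_cosh t).const_mul (-x)).exp).congr_deriv ?_
    linear_combination (x * Real.exp (-x * Real.cosh t)) * Real.cosh_sq t

/-- `x K₁(x)`, that is, minus the Euler derivative of `K₀`. -/
noncomputable def mulBesselK1 (x : ℝ) : ℝ := x * coshLaplace 1 x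

lemma coshLaplace_zero : coshLaplace 0 = besselK0 := by
  funext x
  simp [coshLaplace, besselK0]

lemma hasDerivAt_besselK0 {x : ℝ} (hx : 0 < x) :
    HasDerivAt besselK0 (-(mulBesselK1 x / x)) x := by
  have h := hasDerivAt_coshLaplace 0 hx
  rw [coshLaplace_zero] at h
  rwa [mulBesselK1, mul_div_cancel_left₀ _ hx.ne']

lemma hasDerivAt_mulBesselK1 {x : ℝ} (hx : 0 < x) :
    HasDerivAt mulBesselK1 (-(x * besselK0 x)) x := by
  have h := (hasDerivAt_id x).mul (hasDerivAt_coshLaplace 1 hx)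
  rw [← coshLaplace_zero]
  refine h.congr_deriv ?_
  simp only [id]
  linear_combination coshLaplace_one hx

lemma rpow_mul_le_exp_half {y : ℝ} (hy : 0 < y) :
    y ^ (1 / 8 : ℝ) ≤ 4 * Real.exp (y / 2) ∧ y * y ^ (1 / 8 : ℝ) ≤ 4 * Real.exp (y / 2) := by
  have h1 : y ^ (1 / 8 : ℝ) ≤ Real.exp (y / 8) := by
    have h : y ≤ Real.exp y := by linarith [Real.add_one_le_exp y]
    calc y ^ (1 / 8 : ℝ) ≤ Real.exp y ^ (1 / 8 : ℝ) := Real.rpow_le_rpow hy.le h (by norm_num)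
      _ = Real.exp (y / 8) := by rw [← Real.exp_mul]; ring_nf
  have h2 : y ≤ 4 * Real.exp (y / 4) := by linarith [Real.add_one_le_exp (y / 4)]
  constructor
  · have h3 : Real.exp (y / 8) ≤ Real.exp (y / 2) := by gcongr; norm_num
    linarith [Real.exp_pos (y / 2)]
  · calc y * y ^ (1 / 8 : ℝ) ≤ 4 * Real.exp (y / 4) * Real.exp (y / 8) := by gcongr
      _ = 4 * Real.exp (y / 4 + y / 8) := by rw [Real.exp_add]; ring
      _ ≤ 4 * Real.exp (y / 2) := by gcongr; linarith

lemma mul_exp_neg_mul_cosh_le {p x t : ℝ} (hx : 0 < x)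
    (hp : p * (x * Real.cosh t) ^ (1 / 8 : ℝ) ≤ 4 * Real.exp (x * Real.cosh t / 2)) :
    p * Real.exp (-x * Real.cosh t)
      ≤ 8 * (x ^ (-(1 / 8) : ℝ) * Real.exp (-(1 / 2) * x)) * Real.exp (-(1 / 8) * t) := by
  have hc := Real.cosh_pos t
  have hy : 0 < x * Real.cosh t := by positivity
  have hr : 0 < (x * Real.cosh t) ^ (1 / 8 : ℝ) := by positivity
  have e1 : Real.exp (-x * Real.cosh t)
      = Real.exp (-(x * Real.cosh t / 2)) * Real.exp (-(x * Real.cosh t / 2)) := by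
    rw [← Real.exp_add]; ring_nf
  have e2 : Real.exp (x * Real.cosh t / 2) * Real.exp (-(x * Real.cosh t / 2)) = 1 := by
    rw [← Real.exp_add]; simp
  have h1 : p ≤ 4 * Real.exp (x * Real.cosh t / 2) * (x * Real.cosh t) ^ (-(1 / 8) : ℝ) := by
    rw [Real.rpow_neg hy.le, ← div_eq_mul_inv, le_div_iff₀ hr]
    exact hp
  have h2 : Real.cosh t ^ (-(1 / 8) : ℝ) ≤ 2 * Real.exp (-(1 / 8) * t) := by
    have h3 : Real.exp t / 2 ≤ Real.cosh t := by linarith [exp_le_two_mul_cosh t]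
    calc Real.cosh t ^ (-(1 / 8) : ℝ) ≤ (Real.exp t / 2) ^ (-(1 / 8) : ℝ) :=
          Real.rpow_le_rpow_of_nonpos (by positivity) h3 (by norm_num)
      _ = Real.exp (-(1 / 8) * t) * 2 ^ (1 / 8 : ℝ) := by
          rw [Real.div_rpow (Real.exp_pos t).le (by norm_num), ← Real.exp_mul,
            Real.rpow_neg (by norm_num : (0 : ℝ) ≤ 2), div_inv_eq_mul, mul_comm t]
      _ ≤ Real.exp (-(1 / 8) * t) * 2 ^ (1 : ℝ) := by
          gcongr <;> norm_num
      _ = _ := by rw [Real.rpow_one, mul_comm]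
  have h4 : Real.exp (-(x * Real.cosh t / 2)) ≤ Real.exp (-(1 / 2) * x) := by
    gcongr
    nlinarith [Real.one_le_cosh t]
  calc p * Real.exp (-x * Real.cosh t)
      ≤ 4 * Real.exp (x * Real.cosh t / 2) * (x * Real.cosh t) ^ (-(1 / 8) : ℝ)
        * Real.exp (-x * Real.cosh t) := by gcongr
    _ = 4 * (x ^ (-(1 / 8) : ℝ) * Real.cosh t ^ (-(1 / 8) : ℝ))
        * Real.exp (-(x * Real.cosh t / 2)) := by
        rw [e1, Real.mul_rpow hx.le hc.le]
        linear_combination (4 * (x ^ (-(1 / 8) : ℝ) * Real.cosh t ^ (-(1 / 8) : ℝ))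
          * Real.exp (-(x * Real.cosh t / 2))) * e2
    _ ≤ 4 * (x ^ (-(1 / 8) : ℝ) * (2 * Real.exp (-(1 / 8) * t))) * Real.exp (-(1 / 2) * x) := by
        gcongr
    _ = _ := by ring

lemma setIntegral_le_of_le_mul_exp {f : ℝ → ℝ} {C : ℝ} (hf : ∀ t, 0 ≤ f t)
    (h : ∀ t, f t ≤ 8 * C * Real.exp (-(1 / 8) * t)) :
    |∫ t in Ioi (0 : ℝ), f t| ≤ 64 * C := by
  have hi := integrableOn_exp_mul_Ioi (a := -(1 / 8)) (by norm_num) 0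
  have := norm_integral_le_of_norm_le (μ := volume.restrict (Ioi 0)) (hi.const_mul (8 * C))
    (Eventually.of_forall fun t => (Real.norm_of_nonneg (hf t)).trans_le (h t))
  rw [integral_const_mul, integral_exp_mul_Ioi (by norm_num)] at this
  norm_num at this
  linarith

lemma abs_besselK0_le {x : ℝ} (hx : 0 < x) :
    |besselK0 x| ≤ 64 * (x ^ (-(1 / 8) : ℝ) * Real.exp (-(1 / 2) * x)) := by
  refine setIntegral_le_of_le_mul_exp (fun t => (Real.exp_pos _).le) fun t => ?_
  have hc := Real.cosh_pos t
  have := mul_exp_neg_mul_cosh_le (p := 1) (t := t) hx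
    (by rw [one_mul]; exact (rpow_mul_le_exp_half (by positivity)).1)
  rwa [one_mul] at this

lemma abs_mulBesselK1_le {x : ℝ} (hx : 0 < x) :
    |mulBesselK1 x| ≤ 64 * (x ^ (-(1 / 8) : ℝ) * Real.exp (-(1 / 2) * x)) := by
  rw [mulBesselK1, coshLaplace, ← integral_const_mul]
  refine setIntegral_le_of_le_mul_exp (fun t => ?_) fun t => ?_
  · have hc := Real.cosh_pos t
    positivity
  · have hc := Real.cosh_pos t
    rw [pow_one, ← mul_assoc]
    exact mul_exp_neg_mul_cosh_le hx (rpow_mul_le_exp_half (by positivity)).2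

lemma abs_pow_mul_besselK0_pow_mul_mulBesselK1_pow_le (k i j : ℕ) {x : ℝ} (hx : 0 < x) :
    |x ^ k * (besselK0 x ^ i * mulBesselK1 x ^ j)|
      ≤ 64 ^ (i + j) * (x ^ (k - (i + j : ℕ) / 8 : ℝ) * Real.exp (-((i + j : ℕ) / 2) * x)) := by
  have h1 := abs_besselK0_le hx
  have h2 := abs_mulBesselK1_le hx
  rw [abs_mul, abs_mul, abs_pow, abs_pow, abs_pow, abs_of_pos hx]
  set E := x ^ (-(1 / 8) : ℝ) * Real.exp (-(1 / 2) * x) with hE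
  calc x ^ k * (|besselK0 x| ^ i * |mulBesselK1 x| ^ j)
      ≤ x ^ k * ((64 * E) ^ i * (64 * E) ^ j) := by gcongr
    _ = 64 ^ (i + j) * (x ^ k * E ^ (i + j)) := by rw [← pow_add, mul_pow]; ring
    _ = _ := by
      rw [hE, mul_pow, ← Real.exp_nat_mul, ← Real.rpow_natCast (x ^ _), ← Real.rpow_mul hx.le,
        ← Real.rpow_natCast x k, ← mul_assoc (x ^ _), ← Real.rpow_add hx]
      ring_nf

lemma integrableOn_pow_mul_besselK0_pow_mul_mulBesselK1_pow (k : ℕ) {i j : ℕ}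
    (h0 : 0 < i + j) (h8 : i + j < 8) :
    IntegrableOn (fun x => x ^ k * (besselK0 x ^ i * mulBesselK1 x ^ j)) (Ioi 0) := by
  have hm0 : (0 : ℝ) < (i + j : ℕ) := by exact_mod_cast h0
  have hm8 : ((i + j : ℕ) : ℝ) < 8 := by exact_mod_cast h8
  have hk : (0 : ℝ) ≤ k := by positivity
  have hi := integrableOn_rpow_mul_exp_neg_mul_rpow (p := 1) (s := k - (i + j : ℕ) / 8)
    (b := (i + j : ℕ) / 2) (by linarith) one_pos (by linarith)
  simp only [Real.rpow_one] at hi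
  refine Integrable.mono' (hi.const_mul (64 ^ (i + j))) ?_ ?_
  · refine ContinuousOn.aestronglyMeasurable (fun x hx => ContinuousAt.continuousWithinAt ?_)
      measurableSet_Ioi
    have c1 := (hasDerivAt_besselK0 hx).continuousAt
    have c2 := (hasDerivAt_mulBesselK1 hx).continuousAt
    fun_prop
  · filter_upwards [ae_restrict_mem measurableSet_Ioi] with x hx
    exact abs_pow_mul_besselK0_pow_mul_mulBesselK1_pow_le k i j hx

/-- `∫₀^∞ x^k K₀(x)^i (x K₁(x))^j dx`. -/
noncomputable def mixedBesselMoment (i j k : ℕ) : ℝ :=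
  ∫ x in Ioi (0 : ℝ), x ^ k * (besselK0 x ^ i * mulBesselK1 x ^ j)

lemma mixedBesselMoment_relation {i j : ℕ} (h0 : 1 < i + j) (h7 : i + j < 7) (k : ℕ) :
    ((k : ℝ) + 1) * mixedBesselMoment i j k
      = i * mixedBesselMoment (i - 1) (j + 1) k + j * mixedBesselMoment (i + 1) (j - 1) (k + 2) := by
  have i1 := (integrableOn_pow_mul_besselK0_pow_mul_mulBesselK1_pow k
    (i := i) (j := j) (by lia) (by lia)).const_mul ((k : ℝ) + 1)
  have i2 := (integrableOn_pow_mul_besselK0_pow_mul_mulBesselK1_pow k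
    (i := i - 1) (j := j + 1) (by lia) (by lia)).const_mul (i : ℝ)
  have i3 := (integrableOn_pow_mul_besselK0_pow_mul_mulBesselK1_pow (k + 2)
    (i := i + 1) (j := j - 1) (by lia) (by lia)).const_mul (j : ℝ)
  have i4 : IntegrableOn (fun x => i * (x ^ k * (besselK0 x ^ (i - 1) * mulBesselK1 x ^ (j + 1)))
      + j * (x ^ (k + 2) * (besselK0 x ^ (i + 1) * mulBesselK1 x ^ (j - 1)))) (Ioi 0) := i2.add i3
  have hm0 : (0 : ℝ) < (i + j : ℕ) := by exact_mod_cast (by lia : 0 < i + j)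
  have hm8 : ((i + j : ℕ) : ℝ) < 8 := by exact_mod_cast (by lia : i + j < 8)
  have hbound := fun x (hx : 0 < x) =>
    abs_pow_mul_besselK0_pow_mul_mulBesselK1_pow_le (k + 1) i j hx
  have hk : (0 : ℝ) < (k + 1 : ℕ) - (i + j : ℕ) / 8 := by
    push_cast at hm8 ⊢
    have : (0 : ℝ) ≤ k := by positivity
    linarith
  have key := integral_Ioi_of_hasDerivAt_of_tendsto (a := 0) (m := 0)
    (f := fun x => x ^ (k + 1) * (besselK0 x ^ i * mulBesselK1 x ^ j))
    (f' := fun x => (k + 1) * (x ^ k * (besselK0 x ^ i * mulBesselK1 x ^ j))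
      - (i * (x ^ k * (besselK0 x ^ (i - 1) * mulBesselK1 x ^ (j + 1)))
        + j * (x ^ (k + 2) * (besselK0 x ^ (i + 1) * mulBesselK1 x ^ (j - 1)))))
    ?_ ?_ (i1.sub i4) ?_
  · rw [integral_sub i1 i4, integral_add i2 i3, integral_const_mul, integral_const_mul,
      integral_const_mul] at key
    simp only [ne_eq, Nat.add_eq_zero_iff, one_ne_zero, and_false, not_false_eq_true, zero_pow,
      zero_mul, sub_zero] at key
    exact sub_eq_zero.mp key
  · rw [← continuousWithinAt_Ioi_iff_Ici, ContinuousWithinAt]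
    simp only [ne_eq, Nat.add_eq_zero_iff, one_ne_zero, and_false, not_false_eq_true, zero_pow,
      zero_mul]
    have hg : Tendsto (fun x : ℝ => 64 ^ (i + j) * (x ^ ((k + 1 : ℕ) - (i + j : ℕ) / 8 : ℝ)
        * Real.exp (-((i + j : ℕ) / 2) * x))) (𝓝[>] 0) (𝓝 0) := by
      have hc : ContinuousAt (fun x : ℝ => 64 ^ (i + j) * (x ^ ((k + 1 : ℕ) - (i + j : ℕ) / 8 : ℝ)
        * Real.exp (-((i + j : ℕ) / 2) * x))) 0 := by
        have := Real.continuousAt_rpow_const 0 ((k + 1 : ℕ) - (i + j : ℕ) / 8 : ℝ) (Or.inr hk.le)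
        fun_prop
      have := hc.tendsto.mono_left (nhdsWithin_le_nhds (s := Ioi 0))
      simpa only [Real.zero_rpow hk.ne', zero_mul, mul_zero] using this
    refine squeeze_zero_norm' ?_ hg
    filter_upwards [self_mem_nhdsWithin] with x hx using hbound x hx
  · intro x hx
    have hx0 : x ≠ 0 := ne_of_gt hx
    refine ((hasDerivAt_pow (k + 1) x).mul
      (((hasDerivAt_besselK0 hx).pow i).mul ((hasDerivAt_mulBesselK1 hx).pow j))).congr_deriv ?_
    simp only [Nat.add_sub_cancel, Pi.pow_apply, Pi.mul_apply]
    push_cast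
    field_simp
    ring
  · have hg := (tendsto_rpow_mul_exp_neg_mul_atTop_nhds_zero
      ((k + 1 : ℕ) - (i + j : ℕ) / 8) ((i + j : ℕ) / 2) (by linarith)).const_mul
        ((64 : ℝ) ^ (i + j))
    rw [mul_zero] at hg
    refine squeeze_zero_norm' ?_ hg
    filter_upwards [eventually_gt_atTop 0] with x hx using hbound x hx

lemma besselMoment_eq_mixedBesselMoment (m k : ℕ) :
    besselMoment m k = mixedBesselMoment m 0 k := by
  simp [besselMoment, mixedBesselMoment]

/-- The three-term recursion for the moments `c_{4,k}`. -/
lemma besselMoment_four_recursion (k : ℕ) :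
    ((k : ℝ) + 1) ^ 5 * besselMoment 4 k
      - 4 * (k + 2) * (5 * ((k : ℝ) + 2) ^ 2 + 3) * besselMoment 4 (k + 2)
      + 64 * (k + 3) * besselMoment 4 (k + 4) = 0 := by
  simp only [besselMoment_eq_mixedBesselMoment]
  have r0 := mixedBesselMoment_relation (i := 4) (j := 0) (by lia) (by lia)
  have r1 := mixedBesselMoment_relation (i := 3) (j := 1) (by lia) (by lia)
  have r2 := mixedBesselMoment_relation (i := 2) (j := 2) (by lia) (by lia)
  have r3 := mixedBesselMoment_relation (i := 1) (j := 3) (by lia) (by lia) k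
  have r4 := mixedBesselMoment_relation (i := 0) (j := 4) (by lia) (by lia) k
  have p0 := r0 k
  have p1 := r1 k
  have p2 := r2 k
  have q0 := r0 (k + 2)
  have q1 := r1 (k + 2)
  have q2 := r2 (k + 2)
  have s0 := r0 (k + 4)
  norm_num [add_assoc] at p0 p1 p2 q0 q1 q2 r3 r4 s0
  linear_combination ((k : ℝ) + 1) ^ 4 * p0 + 4 * ((k : ℝ) + 1) ^ 3 * p1
    + 12 * ((k : ℝ) + 1) ^ 2 * p2 + 24 * ((k : ℝ) + 1) * r3 + 24 * r4 - 48 * q2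
    - (40 * ((k : ℝ) + 1) + 32) * q1
    - ((40 * ((k : ℝ) + 1) + 32) * (k + 3) + 24 * ((k : ℝ) + 1) ^ 2) / 4 * q0 + 24 * s0

/-- With `d_n = (16^n/(n!)²) c_{4,2n+1}`, for every `n ≥ 0`,
`(n+2)³ d_{n+2} − 2(2n+3)(5n²+15n+12) d_{n+1} + 64(n+1)³ d_n = 0`. -/
theorem bessel_moment_four_d_recursion
    (d : ℕ → ℝ) (hd : ∀ n, d n = 16 ^ n / (n.factorial : ℝ) ^ 2 * besselMoment 4 (2 * n + 1))
    (n : ℕ) :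
    ((n : ℝ) + 2) ^ 3 * d (n + 2)
      - 2 * (2 * (n : ℝ) + 3) * (5 * (n : ℝ) ^ 2 + 15 * n + 12) * d (n + 1)
      + 64 * ((n : ℝ) + 1) ^ 3 * d n = 0 := by
  have h := besselMoment_four_recursion (2 * n + 1)
  rw [hd, hd, hd, show 2 * (n + 2) + 1 = 2 * n + 1 + 4 by ring,
    show 2 * (n + 1) + 1 = 2 * n + 1 + 2 by ring]
  have hf : (n.factorial : ℝ) ≠ 0 := by positivity
  have h1 : (n : ℝ) + 1 ≠ 0 := by positivity
  have h2 : (n : ℝ) + 2 ≠ 0 := by positivity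
  have e1 : ((n + 1).factorial : ℝ) = (n + 1) * n.factorial := by
    rw [Nat.factorial_succ]; push_cast; ring
  have e2 : ((n + 2).factorial : ℝ) = (n + 2) * ((n + 1) * n.factorial) := by
    rw [Nat.factorial_succ, Nat.cast_mul, e1]; push_cast; ring
  rw [e1, e2, pow_add, pow_add]
  push_cast at h
  field_simp
  linear_combination 2 * 16 ^ n * h
end

section
/- For every integer n ≥ 0, the Bessel moments satisfy the recursion 225·c_{5,n+6} − (259n²+1554n+2435)·c_{5,n+4} + (35n⁴+280n³+882n²+1288n+731)·c_{5,n+2} − (n+1)⁶·c_{5,n} = 0. -/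
open MeasureTheory

open Set Filter Topology

/-- The integral `∫₀^∞ (cosh t)^p exp(−x cosh t) dt`, which up to sign is the `p`-th derivative
of `K₀`. -/
noncomputable def besselCosh (p : ℕ) (x : ℝ) : ℝ :=
  ∫ t in Ioi (0 : ℝ), Real.cosh t ^ p * Real.exp (-x * Real.cosh t)

lemma besselK0_eq_besselCosh : besselK0 = besselCosh 0 := by
  ext x
  simp [besselK0, besselCosh]

lemma rpow_le_const_mul_exp_half {s y : ℝ} (hs : 0 < s) (hy : 0 < y) :
    y ^ s ≤ (2 * s) ^ s * Real.exp (y / 2) := by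
  have h2s : 0 < 2 * s := by positivity
  have h : y / (2 * s) ≤ Real.exp (y / (2 * s)) := by
    linarith [Real.add_one_le_exp (y / (2 * s))]
  have hle : y ≤ 2 * s * Real.exp (y / (2 * s)) := by
    calc y = 2 * s * (y / (2 * s)) := by field_simp
      _ ≤ _ := by gcongr
  calc y ^ s ≤ (2 * s * Real.exp (y / (2 * s))) ^ s := Real.rpow_le_rpow hy.le hle hs.le
    _ = (2 * s) ^ s * Real.exp (y / 2) := by
      rw [Real.mul_rpow h2s.le (Real.exp_pos _).le, ← Real.exp_mul]
      congr 2
      field_simp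

lemma exists_cosh_pow_mul_exp_le (p : ℕ) :
    ∃ C : ℝ, 0 < C ∧ ∀ x : ℝ, 0 < x → ∀ t : ℝ,
      Real.cosh t ^ p * Real.exp (-x * Real.cosh t) ≤
        C * (x ^ (-(p + 1 / 8) : ℝ) * Real.exp (-x / 2)) * Real.exp (-1 / 8 * t) := by
  have hs : (0 : ℝ) < p + 1 / 8 := by positivity
  set s : ℝ := p + 1 / 8 with hs_def
  refine ⟨(2 * s) ^ s * 2 ^ (1 / 8 : ℝ), by positivity, fun x hx t ↦ ?_⟩
  have hc1 : 1 ≤ Real.cosh t := Real.one_le_cosh t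
  set c := Real.cosh t with hc_def
  have hc : 0 < c := by linarith
  have hct : Real.exp t / 2 ≤ c := by
    rw [hc_def, Real.cosh_eq]
    linarith [Real.exp_pos (-t)]
  have hdecay : c ^ (-(1 / 8) : ℝ) ≤ 2 ^ (1 / 8 : ℝ) * Real.exp (-1 / 8 * t) := by
    calc c ^ (-(1 / 8) : ℝ) ≤ (Real.exp t / 2) ^ (-(1 / 8) : ℝ) :=
          Real.rpow_le_rpow_of_nonpos (by positivity) hct (by norm_num)
      _ = 2 ^ (1 / 8 : ℝ) * Real.exp (-1 / 8 * t) := by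
          rw [Real.div_rpow (Real.exp_pos t).le (by norm_num), ← Real.exp_mul,
            Real.rpow_neg (by norm_num : (0 : ℝ) ≤ 2), div_inv_eq_mul, mul_comm]
          congr 2
          ring
  have hy : 0 < x * c := by positivity
  have hexp : Real.exp (-(x * c) / 2) ≤ (2 * s) ^ s * (x * c) ^ (-s) := by
    rw [Real.rpow_neg hy.le, ← div_eq_mul_inv, le_div_iff₀ (by positivity)]
    calc Real.exp (-(x * c) / 2) * (x * c) ^ s
        ≤ Real.exp (-(x * c) / 2) * ((2 * s) ^ s * Real.exp (x * c / 2)) := by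
          gcongr
          exact rpow_le_const_mul_exp_half hs hy
      _ = (2 * s) ^ s := by
          rw [mul_left_comm, ← Real.exp_add]
          ring_nf
          simp
  have hsplit : Real.exp (-x * c) = Real.exp (-(x * c) / 2) * Real.exp (-(x * c) / 2) := by
    rw [← Real.exp_add]
    ring_nf
  have hhalf : Real.exp (-(x * c) / 2) ≤ Real.exp (-x / 2) := by
    apply Real.exp_le_exp.mpr
    nlinarith
  have hcp : c ^ p * c ^ (-s) = c ^ (-(1 / 8) : ℝ) := by
    rw [← Real.rpow_natCast c p, ← Real.rpow_add hc]
    congr 1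
    rw [hs_def]
    ring
  calc c ^ p * Real.exp (-x * c)
      ≤ c ^ p * (((2 * s) ^ s * (x * c) ^ (-s)) * Real.exp (-x / 2)) := by
        rw [hsplit]
        gcongr
    _ = (2 * s) ^ s * (x ^ (-s) * Real.exp (-x / 2)) * c ^ (-(1 / 8) : ℝ) := by
        rw [Real.mul_rpow hx.le hc.le, ← hcp]
        ring
    _ ≤ (2 * s) ^ s * (x ^ (-s) * Real.exp (-x / 2)) *
          (2 ^ (1 / 8 : ℝ) * Real.exp (-1 / 8 * t)) := by gcongr
    _ = _ := by ring

lemma integrableOn_exp_neg_eighth :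
    IntegrableOn (fun t : ℝ ↦ Real.exp (-1 / 8 * t)) (Ioi 0) :=
  integrableOn_exp_mul_Ioi (by norm_num) 0

lemma integrableOn_cosh_pow_mul_exp (p : ℕ) {x : ℝ} (hx : 0 < x) :
    IntegrableOn (fun t : ℝ ↦ Real.cosh t ^ p * Real.exp (-x * Real.cosh t)) (Ioi 0) := by
  obtain ⟨C, -, h⟩ := exists_cosh_pow_mul_exp_le p
  refine Integrable.mono'
    (integrableOn_exp_neg_eighth.const_mul (C * (x ^ (-(p + 1 / 8) : ℝ) * Real.exp (-x / 2))))
    (Continuous.aestronglyMeasurable (by fun_prop)) (ae_of_all _ fun t ↦ ?_)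
  rw [Real.norm_of_nonneg (by positivity)]
  exact h x hx t

lemma exists_besselCosh_le (p : ℕ) :
    ∃ C : ℝ, 0 < C ∧ ∀ x : ℝ, 0 < x →
      besselCosh p x ≤ C * (x ^ (-(p + 1 / 8) : ℝ) * Real.exp (-x / 2)) := by
  obtain ⟨C, hC, h⟩ := exists_cosh_pow_mul_exp_le p
  have hI : ∫ t in Ioi (0 : ℝ), Real.exp (-1 / 8 * t) = 8 := by
    rw [integral_exp_mul_Ioi (by norm_num)]
    norm_num
  refine ⟨C * 8, by positivity, fun x hx ↦ ?_⟩
  calc besselCosh p x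
      ≤ ∫ t in Ioi (0 : ℝ), C * (x ^ (-(p + 1 / 8) : ℝ) * Real.exp (-x / 2)) *
          Real.exp (-1 / 8 * t) :=
        integral_mono (integrableOn_cosh_pow_mul_exp p hx)
          (integrableOn_exp_neg_eighth.const_mul _) (h x hx)
    _ = _ := by
        rw [integral_const_mul, hI]
        ring

lemma besselCosh_nonneg (p : ℕ) (x : ℝ) : 0 ≤ besselCosh p x :=
  integral_nonneg fun t ↦ by positivity

lemma hasDerivAt_besselCosh (p : ℕ) {x : ℝ} (hx : 0 < x) :
    HasDerivAt (besselCosh p) (-besselCosh (p + 1) x) x := by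
  have key := (hasDerivAt_integral_of_dominated_loc_of_deriv_le
    (μ := volume.restrict (Ioi (0 : ℝ)))
    (F := fun x t ↦ Real.cosh t ^ p * Real.exp (-x * Real.cosh t))
    (F' := fun x t ↦ -(Real.cosh t ^ (p + 1) * Real.exp (-x * Real.cosh t)))
    (bound := fun t ↦ Real.cosh t ^ (p + 1) * Real.exp (-(x / 2) * Real.cosh t))
    (s := Ioi (x / 2)) (x₀ := x) (Ioi_mem_nhds (by linarith))
    (Eventually.of_forall fun y ↦ Continuous.aestronglyMeasurable (by fun_prop))
    (integrableOn_cosh_pow_mul_exp p hx)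
    (Continuous.aestronglyMeasurable (by fun_prop))
    (ae_of_all _ fun t y hy ↦ ?_)
    (integrableOn_cosh_pow_mul_exp (p + 1) (half_pos hx))
    (ae_of_all _ fun t y _ ↦ ?_)).2
  · rw [integral_neg] at key
    exact key
  · rw [norm_neg, Real.norm_of_nonneg (by positivity)]
    have := Real.cosh_pos t
    have hy' : x / 2 ≤ y := le_of_lt hy
    gcongr
  · convert! (((hasDerivAt_id y).neg.mul_const (Real.cosh t)).exp.const_mul
      (Real.cosh t ^ p)) using 1
    simp only [id, Pi.neg_apply]
    ring

lemma besselCosh_one_eq {x : ℝ} (hx : 0 < x) :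
    besselCosh 1 x = x * (besselCosh 2 x - besselCosh 0 x) := by
  have h0 := integrableOn_cosh_pow_mul_exp 0 hx
  have h1 := integrableOn_cosh_pow_mul_exp 1 hx
  have h2 := integrableOn_cosh_pow_mul_exp 2 hx
  have h20 : IntegrableOn (fun t ↦ x * (Real.cosh t ^ 2 * Real.exp (-x * Real.cosh t) -
      Real.cosh t ^ 0 * Real.exp (-x * Real.cosh t))) (Ioi 0) := (h2.sub h0).const_mul x
  obtain ⟨C, hC, h⟩ := exists_cosh_pow_mul_exp_le 1
  have hlim : Tendsto (fun t ↦ Real.sinh t * Real.exp (-x * Real.cosh t)) atTop (𝓝 0) := by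
    have hexp : Tendsto (fun t : ℝ ↦ Real.exp (-1 / 8 * t)) atTop (𝓝 0) :=
      Real.tendsto_exp_atBot.comp (tendsto_id.const_mul_atTop_of_neg (by norm_num))
    have hbound := hexp.const_mul (C * (x ^ (-((1 : ℕ) + 1 / 8) : ℝ) * Real.exp (-x / 2)))
    rw [mul_zero] at hbound
    refine squeeze_zero_norm (fun t ↦ ?_) hbound
    refine le_trans ?_ (h x hx t)
    rw [norm_mul, Real.norm_of_nonneg (Real.exp_pos _).le, pow_one, Real.norm_eq_abs]
    gcongr
    rw [abs_le]
    constructor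
    · linarith [Real.cosh_add_sinh t, Real.exp_pos t]
    · exact (Real.sinh_lt_cosh t).le
  have key := integral_Ioi_of_hasDerivAt_of_tendsto' (a := (0 : ℝ))
    (f := fun t ↦ Real.sinh t * Real.exp (-x * Real.cosh t))
    (f' := fun t ↦ Real.cosh t ^ 1 * Real.exp (-x * Real.cosh t) -
      x * (Real.cosh t ^ 2 * Real.exp (-x * Real.cosh t) -
        Real.cosh t ^ 0 * Real.exp (-x * Real.cosh t)))
    (fun t _ ↦ ?_) (h1.sub h20) hlim
  · rw [integral_sub h1 h20, integral_const_mul, integral_sub h2 h0] at key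
    simp only [Real.sinh_zero, zero_mul, sub_zero] at key
    simp only [besselCosh]
    linarith
  · convert! (Real.hasDerivAt_sinh t).mul
      (((Real.hasDerivAt_cosh t).const_mul (-x)).exp) using 1
    rw [pow_zero, pow_one, Real.cosh_sq]
    ring

lemma hasDerivAt_mul_besselCosh_one {x : ℝ} (hx : 0 < x) :
    HasDerivAt (fun y ↦ y * besselCosh 1 y) (-(x * besselCosh 0 x)) x := by
  convert! (hasDerivAt_id x).mul (hasDerivAt_besselCosh 1 hx) using 1
  simp only [id]
  linarith [besselCosh_one_eq hx]

/-- The integrand `x^k K₀(x)^a (x K₁(x))^b`. -/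
noncomputable def mixedIntegrand (k a b : ℕ) (x : ℝ) : ℝ :=
  x ^ k * besselCosh 0 x ^ a * (x * besselCosh 1 x) ^ b

lemma exists_mixedIntegrand_le (k : ℕ) {a b : ℕ} (hab : a + b = 5) :
    ∃ C : ℝ, 0 < C ∧ ∀ x : ℝ, 0 < x →
      mixedIntegrand k a b x ≤ C * (x ^ (k - 5 / 8 : ℝ) * Real.exp (-(5 / 2) * x)) := by
  obtain ⟨C₀, hC₀, h₀⟩ := exists_besselCosh_le 0
  obtain ⟨C₁, hC₁, h₁⟩ := exists_besselCosh_le 1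
  refine ⟨C₀ ^ a * C₁ ^ b, by positivity, fun x hx ↦ ?_⟩
  set w : ℝ := x ^ (-(1 / 8) : ℝ) * Real.exp (-x / 2) with hw
  have hA : besselCosh 0 x ≤ C₀ * w := by simpa [hw] using h₀ x hx
  have hB : x * besselCosh 1 x ≤ C₁ * w := by
    calc x * besselCosh 1 x
        ≤ x * (C₁ * (x ^ (-((1 : ℕ) + 1 / 8) : ℝ) * Real.exp (-x / 2))) := by
          gcongr
          exact h₁ x hx
      _ = C₁ * w := by
          have : (-(1 / 8) : ℝ) = 1 + -((1 : ℕ) + 1 / 8) := by norm_num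
          rw [hw, this, Real.rpow_add hx, Real.rpow_one]
          ring
  have hw5 : x ^ k * w ^ 5 = x ^ (k - 5 / 8 : ℝ) * Real.exp (-(5 / 2) * x) := by
    rw [hw, mul_pow, ← Real.rpow_natCast (x ^ (-(1 / 8) : ℝ)) 5, ← Real.rpow_mul hx.le,
      ← Real.exp_nat_mul, ← mul_assoc, ← Real.rpow_natCast x k, ← Real.rpow_add hx]
    congr 2
    · push_cast
      ring
    · push_cast
      ring
  have hA0 := besselCosh_nonneg 0 x
  have hB0 := besselCosh_nonneg 1 x
  calc mixedIntegrand k a b x ≤ x ^ k * (C₀ * w) ^ a * (C₁ * w) ^ b := by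
        unfold mixedIntegrand
        gcongr
    _ = C₀ ^ a * C₁ ^ b * (x ^ k * w ^ 5) := by
        rw [← hab]
        ring
    _ = _ := by rw [hw5]

lemma mixedIntegrand_nonneg (k a b : ℕ) {x : ℝ} (hx : 0 ≤ x) : 0 ≤ mixedIntegrand k a b x := by
  have hA0 := besselCosh_nonneg 0 x
  have hB0 := besselCosh_nonneg 1 x
  unfold mixedIntegrand
  positivity

lemma hasDerivAt_mixedIntegrand (k a b : ℕ) {x : ℝ} (hx : 0 < x) :
    HasDerivAt (mixedIntegrand (k + 1) a b)
      ((k + 1) * mixedIntegrand k a b x - a * mixedIntegrand k (a - 1) (b + 1) x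
        - b * mixedIntegrand (k + 2) (a + 1) (b - 1) x) x := by
  convert! (((hasDerivAt_id x).pow (k + 1)).mul ((hasDerivAt_besselCosh 0 hx).pow a)).mul
    ((hasDerivAt_mul_besselCosh_one hx).pow b) using 1
  simp only [mixedIntegrand, id, Pi.mul_apply, Pi.pow_apply]
  push_cast
  ring

lemma integrableOn_mixedIntegrand (k : ℕ) {a b : ℕ} (hab : a + b = 5) :
    IntegrableOn (mixedIntegrand k a b) (Ioi 0) := by
  obtain ⟨C, -, h⟩ := exists_mixedIntegrand_le k hab
  have hint : IntegrableOn (fun x : ℝ ↦ x ^ (k - 5 / 8 : ℝ) * Real.exp (-(5 / 2) * x)) (Ioi 0) := by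
    have hk : (0 : ℝ) ≤ k := k.cast_nonneg
    simpa using integrableOn_rpow_mul_exp_neg_mul_rpow (p := 1) (s := k - 5 / 8) (b := 5 / 2)
      (by linarith) one_pos (by norm_num)
  have hcont : ContinuousOn (mixedIntegrand k a b) (Ioi 0) := by
    intro x hx
    exact ((((hasDerivAt_id x).pow k).continuousAt.mul
      ((hasDerivAt_besselCosh 0 hx).pow a).continuousAt).mul
      ((hasDerivAt_mul_besselCosh_one hx).pow b).continuousAt).continuousWithinAt
  refine Integrable.mono' (hint.const_mul C) (hcont.aestronglyMeasurable measurableSet_Ioi)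
    ((ae_restrict_iff' measurableSet_Ioi).mpr (ae_of_all _ fun x hx ↦ ?_))
  rw [Real.norm_of_nonneg (mixedIntegrand_nonneg k a b (le_of_lt hx))]
  exact h x hx

lemma mixedIntegrand_succ_zero (k a b : ℕ) : mixedIntegrand (k + 1) a b 0 = 0 := by
  simp [mixedIntegrand]

lemma continuousWithinAt_mixedIntegrand_succ_zero (k : ℕ) {a b : ℕ} (hab : a + b = 5) :
    ContinuousWithinAt (mixedIntegrand (k + 1) a b) (Ici 0) 0 := by
  obtain ⟨C, hC, h⟩ := exists_mixedIntegrand_le (k + 1) hab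
  have hk : (0 : ℝ) < (k + 1 : ℕ) - 5 / 8 := by
    have : (0 : ℝ) ≤ k := k.cast_nonneg
    push_cast
    linarith
  have hbound : ContinuousAt
      (fun x : ℝ ↦ C * (x ^ ((k + 1 : ℕ) - 5 / 8 : ℝ) * Real.exp (-(5 / 2) * x))) 0 :=
    ((Real.continuousAt_rpow_const 0 _ (Or.inr hk.le)).mul (by fun_prop)).const_mul C
  have hlim := hbound.tendsto.mono_left (nhdsWithin_le_nhds (s := Ici 0))
  rw [Real.zero_rpow hk.ne', zero_mul, mul_zero] at hlim
  rw [ContinuousWithinAt, mixedIntegrand_succ_zero]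
  refine tendsto_of_tendsto_of_tendsto_of_le_of_le' tendsto_const_nhds hlim ?_ ?_
  · filter_upwards [self_mem_nhdsWithin] with x hx
    exact mixedIntegrand_nonneg _ _ _ hx
  · filter_upwards [self_mem_nhdsWithin] with x hx
    rcases (mem_Ici.mp hx).eq_or_lt with rfl | hx
    · rw [mixedIntegrand_succ_zero, Real.zero_rpow hk.ne', zero_mul, mul_zero]
    · exact h x hx

lemma tendsto_mixedIntegrand_atTop (k : ℕ) {a b : ℕ} (hab : a + b = 5) :
    Tendsto (mixedIntegrand k a b) atTop (𝓝 0) := by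
  obtain ⟨C, hC, h⟩ := exists_mixedIntegrand_le k hab
  have hlim := (tendsto_rpow_mul_exp_neg_mul_atTop_nhds_zero (k - 5 / 8) (5 / 2)
    (by norm_num)).const_mul C
  rw [mul_zero] at hlim
  refine tendsto_of_tendsto_of_tendsto_of_le_of_le' tendsto_const_nhds hlim ?_ ?_
  · filter_upwards [eventually_gt_atTop 0] with x hx
    exact mixedIntegrand_nonneg _ _ _ hx.le
  · filter_upwards [eventually_gt_atTop 0] with x hx
    exact h x hx

/-- The moment `∫₀^∞ x^k K₀(x)^a (x K₁(x))^b dx`. -/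
noncomputable def mixedMoment (k a b : ℕ) : ℝ :=
  ∫ x in Ioi (0 : ℝ), mixedIntegrand k a b x

lemma mixedMoment_five_zero (k : ℕ) : mixedMoment k 5 0 = besselMoment 5 k := by
  simp [mixedMoment, mixedIntegrand, besselMoment, besselK0_eq_besselCosh]

lemma mixedMoment_relation (k a b : ℕ) (hab : a + b = 5) :
    (k + 1) * mixedMoment k a b
      = a * mixedMoment k (a - 1) (b + 1) + b * mixedMoment (k + 2) (a + 1) (b - 1) := by
  have h₁ : IntegrableOn (fun x ↦ a * mixedIntegrand k (a - 1) (b + 1) x) (Ioi 0) := by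
    rcases a.eq_zero_or_pos with rfl | ha
    · simp
    · exact (integrableOn_mixedIntegrand k (by lia)).const_mul _
  have h₂ : IntegrableOn (fun x ↦ b * mixedIntegrand (k + 2) (a + 1) (b - 1) x) (Ioi 0) := by
    rcases b.eq_zero_or_pos with rfl | hb
    · simp
    · exact (integrableOn_mixedIntegrand _ (by lia)).const_mul _
  have h₀ : IntegrableOn (fun x ↦ ((k : ℝ) + 1) * mixedIntegrand k a b x) (Ioi 0) :=
    (integrableOn_mixedIntegrand k hab).const_mul _
  have h₀₁ : IntegrableOn (fun x ↦ ((k : ℝ) + 1) * mixedIntegrand k a b x -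
      a * mixedIntegrand k (a - 1) (b + 1) x) (Ioi 0) := h₀.sub h₁
  have key := integral_Ioi_of_hasDerivAt_of_tendsto
    (continuousWithinAt_mixedIntegrand_succ_zero k hab)
    (fun x hx ↦ hasDerivAt_mixedIntegrand k a b hx) (h₀₁.sub h₂)
    (tendsto_mixedIntegrand_atTop (k + 1) hab)
  rw [mixedIntegrand_succ_zero, sub_zero, integral_sub h₀₁ h₂, integral_sub h₀ h₁,
    integral_const_mul, integral_const_mul, integral_const_mul] at key
  simp only [mixedMoment]
  linarith

/-- For every `n ≥ 0`,
`225 c_{5,n+6} − (259n²+1554n+2435) c_{5,n+4} + (35n⁴+280n³+882n²+1288n+731) c_{5,n+2}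
  − (n+1)⁶ c_{5,n} = 0`. -/
theorem bessel_moment_five_recursion (n : ℕ) :
    225 * besselMoment 5 (n + 6)
      - (259 * (n : ℝ) ^ 2 + 1554 * n + 2435) * besselMoment 5 (n + 4)
      + (35 * (n : ℝ) ^ 4 + 280 * (n : ℝ) ^ 3 + 882 * (n : ℝ) ^ 2 + 1288 * n + 731)
          * besselMoment 5 (n + 2)
      - ((n : ℝ) + 1) ^ 6 * besselMoment 5 n = 0 := by
  have r00 := mixedMoment_relation n 5 0 rfl
  have r01 := mixedMoment_relation n 4 1 rfl
  have r02 := mixedMoment_relation n 3 2 rfl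
  have r03 := mixedMoment_relation n 2 3 rfl
  have r04 := mixedMoment_relation n 1 4 rfl
  have r05 := mixedMoment_relation n 0 5 rfl
  have r20 := mixedMoment_relation (n + 2) 5 0 rfl
  have r21 := mixedMoment_relation (n + 2) 4 1 rfl
  have r22 := mixedMoment_relation (n + 2) 3 2 rfl
  have r23 := mixedMoment_relation (n + 2) 2 3 rfl
  have r40 := mixedMoment_relation (n + 4) 5 0 rfl
  have r41 := mixedMoment_relation (n + 4) 4 1 rfl
  norm_num [add_assoc] at r00 r01 r02 r03 r04 r05 r20 r21 r22 r23 r40 r41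
  simp only [← mixedMoment_five_zero]
  linear_combination -((n : ℝ) + 1) ^ 5 * r00 - 5 * ((n : ℝ) + 1) ^ 4 * r01
    - 20 * ((n : ℝ) + 1) ^ 3 * r02 - 60 * ((n : ℝ) + 1) ^ 2 * r03 - 120 * ((n : ℝ) + 1) * r04
    - 120 * r05
    + (8 * ((n : ℝ) + 1) ^ 3 + ((n : ℝ) + 3) / 5 *
        (45 * ((n : ℝ) + 1) ^ 2 + ((n : ℝ) + 3) * (65 * n + 115))) * r20
    + (45 * ((n : ℝ) + 1) ^ 2 + ((n : ℝ) + 3) * (65 * n + 115)) * r21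
    + (260 * n + 460) * r22 + 300 * r23
    - (2 * (260 * n + 460) + 225 * ((n : ℝ) + 5)) / 5 * r40 - 225 * r41
end
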